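/- Let H be a Hopf algebra and γ a 2-cocycle on H. Then the map S_γ := u_γ * S * ū_γ (convolution product of u_γ, the antipode S, and ū_γ), explicitly S_γ(h) = u_γ(h₍₁₎) S(h₍₂₎) ū_γ(h₍₃₎), is an antipode for the twisted bialgebra (H, ·_γ, Δ, ε): S_γ(h₍₁₎) ·_γ h₍₂₎ = ε(h)1 = h₍₁₎ ·_γ S_γ(h₍₂₎). -/

import Mathlib

open TensorProduct LinearMap

noncomputable section

variable (R H : Type*) [CommRing R] [Ring H] [HopfAlgebra R H]

/-- The multiplication of `H` as a linear map. -/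
abbrev mulH : H ⊗[R] H →ₗ[R] H := LinearMap.mul' R H

/-- The antipode of `H`. -/
abbrev Sa : H →ₗ[R] H := HopfAlgebra.antipode (R := R)

/-- The comultiplication `h ⊗ k ↦ (h₍₁₎ ⊗ k₍₁₎) ⊗ (h₍₂₎ ⊗ k₍₂₎)` on `H ⊗ H`. -/
def comul2 : H ⊗[R] H →ₗ[R] (H ⊗[R] H) ⊗[R] (H ⊗[R] H) :=
  (tensorTensorTensorComm R H H H H).toLinearMap ∘ₗ map (Coalgebra.comul (R := R)) (Coalgebra.comul (R := R))

/-- The (Coalgebra.counit (R := R)) `h ⊗ k ↦ ε(h)ε(k)` on `H ⊗ H`. -/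
def counit2 : H ⊗[R] H →ₗ[R] R :=
  (TensorProduct.lid R R).toLinearMap ∘ₗ map (Coalgebra.counit (R := R)) (Coalgebra.counit (R := R))

/-- Iterated comultiplication `h ↦ (h₍₁₎ ⊗ h₍₂₎) ⊗ h₍₃₎`. -/
def comul3 : H →ₗ[R] (H ⊗[R] H) ⊗[R] H := map (Coalgebra.comul (R := R)) LinearMap.id ∘ₗ (Coalgebra.comul (R := R))

/-- Iterated comultiplication `h ↦ ((h₍₁₎ ⊗ h₍₂₎) ⊗ h₍₃₎) ⊗ h₍₄₎`. -/
def comul4 : H →ₗ[R] ((H ⊗[R] H) ⊗[R] H) ⊗[R] H := map (comul3 R H) LinearMap.id ∘ₗ (Coalgebra.comul (R := R))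

/-- Convolution product of two functionals with respect to a given comultiplication. -/
def convOn {C : Type*} [AddCommMonoid C] [Module R C]
    (Δc : C →ₗ[R] C ⊗[R] C) (f g : C →ₗ[R] R) : C →ₗ[R] R :=
  LinearMap.mul' R R ∘ₗ map f g ∘ₗ Δc

/-- The comultiplication on the triple tensor product `(H ⊗ H) ⊗ H`. -/
def comulC3 : (H ⊗[R] H) ⊗[R] H →ₗ[R] ((H ⊗[R] H) ⊗[R] H) ⊗[R] ((H ⊗[R] H) ⊗[R] H) :=
  (tensorTensorTensorComm R (H ⊗[R] H) (H ⊗[R] H) H H).toLinearMap ∘ₗ map (comul2 R H) (Coalgebra.comul (R := R))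

/-- `γ` is a 2-cocycle with convolution inverse `γ'` relative to the product `μ`:
convolution invertible, unital, and satisfying the 2-cocycle condition
`γ(g₍₁₎⊗h₍₁₎)γ(g₍₂₎h₍₂₎⊗k) = γ(h₍₁₎⊗k₍₁₎)γ(g⊗h₍₂₎k₍₂₎)`. -/
structure IsCocycle (μ : H ⊗[R] H →ₗ[R] H) (γ γ' : H ⊗[R] H →ₗ[R] R) : Prop where
  cocycle : convOn R (comulC3 R H) (LinearMap.mul' R R ∘ₗ map γ (Coalgebra.counit (R := R))) (γ ∘ₗ map μ LinearMap.id)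
    = convOn R (comulC3 R H)
        (LinearMap.mul' R R ∘ₗ map (Coalgebra.counit (R := R)) γ ∘ₗ (TensorProduct.assoc R H H H).toLinearMap)
        (γ ∘ₗ map LinearMap.id μ ∘ₗ (TensorProduct.assoc R H H H).toLinearMap)
  conv_inv_right : convOn R (comul2 R H) γ γ' = counit2 R H
  conv_inv_left : convOn R (comul2 R H) γ' γ = counit2 R H
  unital_right : ∀ h : H, γ (h ⊗ₜ[R] 1) = (Coalgebra.counit (R := R)) h
  unital_left : ∀ h : H, γ (1 ⊗ₜ[R] h) = (Coalgebra.counit (R := R)) h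

/-- The twisted product `h ·_γ k = γ(h₍₁₎⊗k₍₁₎) h₍₂₎∙k₍₂₎ γ'(h₍₃₎⊗k₍₃₎)`, where `∙` is
the (possibly already deformed) product `μ`. -/
def twistMul (μ : H ⊗[R] H →ₗ[R] H) (γ γ' : H ⊗[R] H →ₗ[R] R) : H ⊗[R] H →ₗ[R] H :=
  (TensorProduct.lid R H).toLinearMap ∘ₗ (TensorProduct.rid R (R ⊗[R] H)).toLinearMap
    ∘ₗ map (map γ μ) γ' ∘ₗ map (comul2 R H) LinearMap.id ∘ₗ comul2 R H

/-- `u_γ(h) = γ(h₍₁₎ ⊗ S(h₍₂₎))`. -/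
def uMap (γ : H ⊗[R] H →ₗ[R] R) : H →ₗ[R] R :=
  γ ∘ₗ map LinearMap.id (Sa R H) ∘ₗ (Coalgebra.comul (R := R))

/-- `ū_γ(h) = γ'(S(h₍₁₎) ⊗ h₍₂₎)`. -/
def ubarMap (γ' : H ⊗[R] H →ₗ[R] R) : H →ₗ[R] R :=
  γ' ∘ₗ map (Sa R H) LinearMap.id ∘ₗ (Coalgebra.comul (R := R))

/-- The twisted antipode `S_γ(h) = u_γ(h₍₁₎) S(h₍₂₎) ū_γ(h₍₃₎)`. -/
def Stw (γ γ' : H ⊗[R] H →ₗ[R] R) : H →ₗ[R] H :=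
  (TensorProduct.lid R H).toLinearMap ∘ₗ (TensorProduct.rid R (R ⊗[R] H)).toLinearMap
    ∘ₗ map (map (uMap R H γ) (Sa R H)) (ubarMap R H γ') ∘ₗ comul3 R H

/-- The (generalized) right adjoint coaction `h ↦ h₍₂₎ ⊗ S'(h₍₁₎) ∙ h₍₃₎`. -/
def AdGen (S' : H →ₗ[R] H) (μ : H ⊗[R] H →ₗ[R] H) : H →ₗ[R] H ⊗[R] H :=
  map LinearMap.id μ ∘ₗ (TensorProduct.assoc R H H H).toLinearMap
    ∘ₗ map ((TensorProduct.comm R H H).toLinearMap ∘ₗ map S' LinearMap.id) LinearMap.id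
    ∘ₗ comul3 R H

/-- The right adjoint coaction `Ad(h) = h₍₂₎ ⊗ S(h₍₁₎)h₍₃₎`. -/
def Ad : H →ₗ[R] H ⊗[R] H := AdGen R H (Sa R H) (mulH R H)

end


section

open Coalgebra HopfAlgebra WithConv

variable {R H : Type*} [CommRing R] [Ring H] [HopfAlgebra R H]
  {A : Type*} [Ring A] [Algebra R A] {M N : Type*} [AddCommGroup M] [Module R M]
  [AddCommGroup N] [Module R N]

theorem comul2_eq : comul2 R H = comul := by
  ext
  simp only [comul2, TensorProduct.comul_def]
  rfl

theorem comulC3_eq : comulC3 R H = comul := by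
  rw [comulC3, comul2_eq]
  rfl

theorem counit2_eq : counit2 R H = counit := by
  ext
  simp [counit2, mul_comm]

theorem convOn_eq {C : Type*} [AddCommGroup C] [Module R C] [Coalgebra R C]
    (f g : C →ₗ[R] R) : convOn R comul f g = (toConv f * toConv g).ofConv :=
  rfl

/-- The antipode is an anti-coalgebra map: `Δ(S h) = S h₍₂₎ ⊗ S h₍₁₎`. -/
theorem comul_antipode : comul ∘ₗ antipode R (A := H) =
    map (antipode R) (antipode R) ∘ₗ (TensorProduct.comm R H H).toLinearMap ∘ₗ comul := by
  let i₁ := (Algebra.TensorProduct.includeLeft : H →ₐ[R] H ⊗[R] H)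
  let i₂ := (Algebra.TensorProduct.includeRight : H →ₐ[R] H ⊗[R] H)
  have key (i : H →ₐ[R] H ⊗[R] H) :
      toConv (i.toLinearMap ∘ₗ antipode R) * toConv i.toLinearMap = 1 := by
    have := LinearMap.algHom_comp_convMul_distrib i (toConv (antipode R (A := H)))
      (toConv LinearMap.id)
    rw [antipode_mul_id] at this
    apply ofConv_injective
    rw [LinearMap.comp_id] at this
    rw [← this]
    ext
    simp
  have hδ : toConv (comul (R := R) (A := H)) =
      toConv i₁.toLinearMap * toConv i₂.toLinearMap := by
    ext a
    simp [(ℛ R a).convMul_apply, i₁, i₂, (ℛ R a).eq]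
  have hG : toConv (map (antipode R) (antipode R) ∘ₗ
        (TensorProduct.comm R H H).toLinearMap ∘ₗ comul (R := R) (A := H)) =
      toConv (i₂.toLinearMap ∘ₗ antipode R) * toConv (i₁.toLinearMap ∘ₗ antipode R) := by
    ext a
    rw [(ℛ R a).convMul_apply]
    conv_lhs => simp [← (ℛ R a).eq]
    simp [i₁, i₂]
  apply toConv_injective
  refine (left_inv_eq_right_inv ?_ comul_right_inv).symm
  rw [hG, hδ, mul_assoc, ← mul_assoc _ (toConv i₁.toLinearMap), key, one_mul, key]

/-- The map `a ⊗ (b ⊗ c) ↦ f(a ⊗ S c) x(b)`. -/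
def contrL (f : H ⊗[R] H →ₗ[R] A) (x : M →ₗ[R] A) : H ⊗[R] (M ⊗[R] H) →ₗ[R] A :=
  mul' R A ∘ₗ map (f ∘ₗ map LinearMap.id (antipode R)) x ∘ₗ
    (TensorProduct.assoc R H H M).symm.toLinearMap ∘ₗ
    map LinearMap.id (TensorProduct.comm R M H).toLinearMap

@[simp] theorem contrL_tmul (f : H ⊗[R] H →ₗ[R] A) (x : M →ₗ[R] A) (a c : H) (b : M) :
    contrL f x (a ⊗ₜ (b ⊗ₜ c)) = f (a ⊗ₜ antipode R c) * x b := by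
  simp [contrL]

/-- The map `a ⊗ (b ⊗ c) ↦ x(b) f(S a ⊗ c)`. -/
def contrR (x : M →ₗ[R] A) (f : H ⊗[R] H →ₗ[R] A) : H ⊗[R] (M ⊗[R] H) →ₗ[R] A :=
  mul' R A ∘ₗ map x (f ∘ₗ map (antipode R) LinearMap.id) ∘ₗ
    (TensorProduct.leftComm R H M H).toLinearMap

@[simp] theorem contrR_tmul (f : H ⊗[R] H →ₗ[R] A) (x : M →ₗ[R] A) (a c : H) (b : M) :
    contrR x f (a ⊗ₜ (b ⊗ₜ c)) = x b * f (antipode R a ⊗ₜ c) := by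
  simp [contrR]

variable (R H) in
/-- Iterated comultiplication `h ↦ h₍₁₎ ⊗ (h₍₂₎ ⊗ h₍₃₎)`. -/
def comul₃ : H →ₗ[R] H ⊗[R] (H ⊗[R] H) := map LinearMap.id comul ∘ₗ comul

/-- The left action `h ↦ f(h₍₁₎ ⊗ S h₍₃₎) x(h₍₂₎)` of the convolution algebra of maps on
`H ⊗ H` on maps on `H`. -/
def actL (f : H ⊗[R] H →ₗ[R] A) (x : H →ₗ[R] A) : H →ₗ[R] A := contrL f x ∘ₗ comul₃ R H

/-- The right action `h ↦ x(h₍₂₎) f(S h₍₁₎ ⊗ h₍₃₎)` of the convolution algebra of maps on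
`H ⊗ H` on maps on `H`. -/
def actR (x : H →ₗ[R] A) (f : H ⊗[R] H →ₗ[R] A) : H →ₗ[R] A := contrR x f ∘ₗ comul₃ R H

theorem contrL_comp (f : H ⊗[R] H →ₗ[R] A) (x : M →ₗ[R] A) (φ : N →ₗ[R] M) :
    contrL f (x ∘ₗ φ) = contrL f x ∘ₗ map LinearMap.id (map φ LinearMap.id) := by
  ext
  simp

theorem contrR_comp (f : H ⊗[R] H →ₗ[R] A) (x : M →ₗ[R] A) (φ : N →ₗ[R] M) :
    contrR (x ∘ₗ φ) f = contrR x f ∘ₗ map LinearMap.id (map φ LinearMap.id) := by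
  ext
  simp

theorem comul₃_comul₃ :
    map LinearMap.id (map (comul₃ R H) LinearMap.id) ∘ₗ comul₃ R H =
      (map .id ((TensorProduct.assoc R _ _ _).symm.toLinearMap ∘ₗ
          map .id (TensorProduct.assoc R _ _ _).symm.toLinearMap) ∘ₗ
        (TensorProduct.assoc R H H (H ⊗[R] (H ⊗[R] H))).toLinearMap) ∘ₗ
        map comul (map .id comul) ∘ₗ comul₃ R H := by
  simp only [comul₃, coassoc_simps]

theorem actL_mul (f g : H ⊗[R] H →ₗ[R] A) (x : H →ₗ[R] A) :
    actL (toConv f * toConv g).ofConv x = actL f (actL g x) := by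
  unfold actL
  rw [contrL_comp, LinearMap.comp_assoc, comul₃_comul₃, ← LinearMap.comp_assoc,
    ← LinearMap.comp_assoc]
  congr 1
  ext a b c
  have := LinearMap.congr_fun (comul_antipode (R := R)) c
  simp [TensorProduct.comul_def] at this ⊢
  simp [this, ← (ℛ R a).eq, ← (ℛ R c).eq, sum_tmul, tmul_sum]
  simp only [Finset.sum_mul, mul_assoc]

theorem actR_mul (f g : H ⊗[R] H →ₗ[R] A) (x : H →ₗ[R] A) :
    actR x (toConv f * toConv g).ofConv = actR (actR x f) g := by
  unfold actR
  rw [contrR_comp, LinearMap.comp_assoc, comul₃_comul₃, ← LinearMap.comp_assoc,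
    ← LinearMap.comp_assoc]
  congr 1
  ext a b c
  have := LinearMap.congr_fun (comul_antipode (R := R)) a
  simp [TensorProduct.comul_def] at this ⊢
  simp [this, ← (ℛ R a).eq, ← (ℛ R c).eq, sum_tmul, tmul_sum]
  simp only [Finset.mul_sum, mul_assoc]

theorem lid_counit_comul :
    (TensorProduct.lid R H).toLinearMap ∘ₗ map counit .id ∘ₗ comul = .id := by
  rw [← rTensor_def, rTensor_counit_comp_comul]
  ext
  simp

theorem rid_counit_comul :
    (TensorProduct.rid R H).toLinearMap ∘ₗ map .id counit ∘ₗ comul = .id := by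
  rw [← lTensor_def, lTensor_counit_comp_comul]
  ext
  simp

theorem actL_one (f : H ⊗[R] H →ₗ[R] A) :
    actL f (1 : WithConv (H →ₗ[R] A)).ofConv = f ∘ₗ map .id (antipode R) ∘ₗ comul := by
  have : contrL f (1 : WithConv (H →ₗ[R] A)).ofConv = f ∘ₗ map .id (antipode R) ∘ₗ
      map .id ((TensorProduct.lid R H).toLinearMap ∘ₗ map counit .id) := by
    ext a b
    simp [LinearMap.convOne_def, Algebra.algebraMap_eq_smul_one]
  simp only [actL, comul₃, this, LinearMap.comp_assoc]
  rw [← LinearMap.comp_assoc _ (map LinearMap.id comul), ← TensorProduct.map_comp,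
    LinearMap.comp_assoc, lid_counit_comul]
  simp

theorem one_actR (f : H ⊗[R] H →ₗ[R] A) :
    actR (1 : WithConv (H →ₗ[R] A)).ofConv f = f ∘ₗ map (antipode R) .id ∘ₗ comul := by
  have : contrR (1 : WithConv (H →ₗ[R] A)).ofConv f = f ∘ₗ map (antipode R) .id ∘ₗ
      map .id ((TensorProduct.lid R H).toLinearMap ∘ₗ map counit .id) := by
    ext a b
    simp [LinearMap.convOne_def, Algebra.algebraMap_eq_smul_one]
  simp only [actR, comul₃, this, LinearMap.comp_assoc]
  rw [← LinearMap.comp_assoc _ (map LinearMap.id comul), ← TensorProduct.map_comp,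
    LinearMap.comp_assoc, lid_counit_comul]
  simp

theorem counit_comul₃ : (TensorProduct.lid R H).toLinearMap ∘ₗ
    map counit ((TensorProduct.rid R H).toLinearMap ∘ₗ map .id counit) ∘ₗ
      comul₃ R H = .id := by
  rw [comul₃, ← LinearMap.comp_assoc comul, ← TensorProduct.map_comp, LinearMap.comp_assoc,
    rid_counit_comul, LinearMap.comp_id, lid_counit_comul]

theorem one_actL (x : H →ₗ[R] A) :
    actL (1 : WithConv (H ⊗[R] H →ₗ[R] A)).ofConv x = x := by
  have : contrL (1 : WithConv (H ⊗[R] H →ₗ[R] A)).ofConv x =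
      x ∘ₗ (TensorProduct.lid R H).toLinearMap ∘ₗ
        map counit ((TensorProduct.rid R H).toLinearMap ∘ₗ map .id counit) := by
    ext
    simp [LinearMap.convOne_def, Algebra.algebraMap_eq_smul_one, smul_smul, mul_comm]
  rw [actL, this, LinearMap.comp_assoc, LinearMap.comp_assoc, counit_comul₃,
    LinearMap.comp_id]

theorem actR_one (x : H →ₗ[R] A) :
    actR x (1 : WithConv (H ⊗[R] H →ₗ[R] A)).ofConv = x := by
  have : contrR x (1 : WithConv (H ⊗[R] H →ₗ[R] A)).ofConv =
      x ∘ₗ (TensorProduct.lid R H).toLinearMap ∘ₗ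
        map counit ((TensorProduct.rid R H).toLinearMap ∘ₗ map .id counit) := by
    ext
    simp [LinearMap.convOne_def, Algebra.algebraMap_eq_smul_one, smul_smul, mul_comm]
  rw [actR, this, LinearMap.comp_assoc, LinearMap.comp_assoc, counit_comul₃,
    LinearMap.comp_id]

theorem comp_id_antipode : mul' R H ∘ₗ map .id (antipode R) ∘ₗ comul =
    (1 : WithConv (H →ₗ[R] H)).ofConv :=
  congrArg ofConv (id_mul_antipode (R := R) (C := H))

theorem comp_antipode_id : mul' R H ∘ₗ map (antipode R) .id ∘ₗ comul =
    (1 : WithConv (H →ₗ[R] H)).ofConv :=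
  congrArg ofConv (antipode_mul_id (R := R) (C := H))

local notation "ι" => Algebra.linearMap R H

theorem twistMul_eq (γ γ' : H ⊗[R] H →ₗ[R] R) : twistMul R H (mulH R H) γ γ' =
    (toConv (ι ∘ₗ γ) * toConv (mul' R H) * toConv (ι ∘ₗ γ')).ofConv := by
  have : (TensorProduct.lid R H).toLinearMap ∘ₗ
      (TensorProduct.rid R (R ⊗[R] H)).toLinearMap ∘ₗ map (map γ (mulH R H)) γ' =
      mul' R H ∘ₗ map (mul' R H ∘ₗ map (ι ∘ₗ γ) (mul' R H)) (ι ∘ₗ γ') := by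
    ext
    simp [Algebra.algebraMap_eq_smul_one, smul_smul, mul_comm]
  rw [twistMul, ← LinearMap.comp_assoc, ← LinearMap.comp_assoc,
    LinearMap.comp_assoc (map _ _), this, comul2_eq]
  simp only [LinearMap.convMul_def, ofConv_toConv, LinearMap.comp_assoc, coassoc_simps]

theorem Stw_eq (γ γ' : H ⊗[R] H →ₗ[R] R) : Stw R H γ γ' =
    ((TensorProduct.lid R H).toLinearMap ∘ₗ (TensorProduct.rid R (R ⊗[R] H)).toLinearMap ∘ₗ
      map (map (uMap R H γ) (antipode R)) (ubarMap R H γ')) ∘ₗ comul3 R H :=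
  rfl

/-- `t(h₍₁₎ ⊗ S_γ h₍₂₎) = t(h₍₁₎ ⊗ S h₍₃₎) u_γ(h₍₂₎) ū_γ(h₍₄₎)`. -/
theorem comp_id_Stw (t : H ⊗[R] H →ₗ[R] H) (γ γ' : H ⊗[R] H →ₗ[R] R) :
    t ∘ₗ map LinearMap.id (Stw R H γ γ') ∘ₗ comul =
      (toConv (actL t (ι ∘ₗ uMap R H γ)) * toConv (ι ∘ₗ ubarMap R H γ')).ofConv := by
  have h₁ (u v : H →ₗ[R] R) : t ∘ₗ map .id ((TensorProduct.lid R H).toLinearMap ∘ₗ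
      (TensorProduct.rid R (R ⊗[R] H)).toLinearMap ∘ₗ map (map u (antipode R)) v) ∘ₗ
        (TensorProduct.assoc R _ _ _).toLinearMap =
      mul' R H ∘ₗ map (contrL t (ι ∘ₗ u)) (ι ∘ₗ v) := by
    ext
    simp [Algebra.algebraMap_eq_smul_one, smul_smul, mul_comm]
  have h₂ : map .id (comul3 R H) ∘ₗ comul =
      (TensorProduct.assoc R _ _ _).toLinearMap ∘ₗ map (comul₃ R H) .id ∘ₗ comul := by
    simp only [comul3, comul₃, coassoc_simps]
  have h₃ (φ : (H ⊗[R] H) ⊗[R] H →ₗ[R] H) : map .id (φ ∘ₗ comul3 R H) ∘ₗ comul =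
      map .id φ ∘ₗ map .id (comul3 R H) ∘ₗ comul := by
    simp only [coassoc_simps]
  have h₄ (φ : H ⊗[R] (H ⊗[R] H) →ₗ[R] H) (y : H →ₗ[R] H) :
      map (φ ∘ₗ comul₃ R H) y ∘ₗ comul = map φ y ∘ₗ map (comul₃ R H) .id ∘ₗ comul := by
    simp only [coassoc_simps]
  rw [LinearMap.convMul_def, ofConv_toConv, ofConv_toConv, ofConv_toConv, actL, h₄, Stw_eq,
    h₃, h₂]
  have h₅ := congrArg (· ∘ₗ map (comul₃ R H) .id ∘ₗ comul) (h₁ (uMap R H γ) (ubarMap R H γ'))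
  simp only [LinearMap.comp_assoc] at h₅ ⊢
  exact h₅

/-- `t(S_γ h₍₁₎ ⊗ h₍₂₎) = u_γ(h₍₁₎) ū_γ(h₍₃₎) t(S h₍₂₎ ⊗ h₍₄₎)`. -/
theorem comp_Stw_id (t : H ⊗[R] H →ₗ[R] H) (γ γ' : H ⊗[R] H →ₗ[R] R) :
    t ∘ₗ map (Stw R H γ γ') LinearMap.id ∘ₗ comul =
      (toConv (ι ∘ₗ uMap R H γ) * toConv (actR (ι ∘ₗ ubarMap R H γ') t)).ofConv := by
  have h₁ (u v : H →ₗ[R] R) : t ∘ₗ map ((TensorProduct.lid R H).toLinearMap ∘ₗ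
      (TensorProduct.rid R (R ⊗[R] H)).toLinearMap ∘ₗ map (map u (antipode R)) v) .id =
      mul' R H ∘ₗ map (ι ∘ₗ u) (contrR (ι ∘ₗ v) t) ∘ₗ
        map .id (TensorProduct.assoc R _ _ _).toLinearMap ∘ₗ
        (TensorProduct.assoc R _ _ _).toLinearMap ∘ₗ
        map (TensorProduct.assoc R _ _ _).toLinearMap .id := by
    ext
    simp [Algebra.algebraMap_eq_smul_one, smul_smul, mul_comm, ← smul_tmul']
  have h₂ : (map .id (TensorProduct.assoc R _ _ _).toLinearMap ∘ₗ
      (TensorProduct.assoc R _ _ _).toLinearMap ∘ₗ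
        map (TensorProduct.assoc R _ _ _).toLinearMap .id) ∘ₗ map (comul3 R H) .id ∘ₗ comul =
      map .id (comul₃ R H) ∘ₗ comul := by
    simp only [comul3, comul₃, coassoc_simps]
  have h₃ (φ : (H ⊗[R] H) ⊗[R] H →ₗ[R] H) : map (φ ∘ₗ comul3 R H) .id ∘ₗ comul =
      map φ .id ∘ₗ map (comul3 R H) .id ∘ₗ comul := by
    simp only [coassoc_simps]
  have h₄ (φ : H ⊗[R] (H ⊗[R] H) →ₗ[R] H) (y : H →ₗ[R] H) :
      map y (φ ∘ₗ comul₃ R H) ∘ₗ comul = map y φ ∘ₗ map .id (comul₃ R H) ∘ₗ comul := by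
    simp only [coassoc_simps]
  rw [LinearMap.convMul_def, ofConv_toConv, ofConv_toConv, ofConv_toConv, actR, h₄, ← h₂,
    Stw_eq, h₃]
  have h₅ := congrArg (· ∘ₗ map (comul3 R H) .id ∘ₗ comul) (h₁ (uMap R H γ) (ubarMap R H γ'))
  simp only [LinearMap.comp_assoc] at h₅ ⊢
  exact h₅

theorem conv_linearMap_comp_eq_one {C : Type*} [AddCommGroup C] [Module R C] [Coalgebra R C]
    {f g : C →ₗ[R] R} (h : toConv f * toConv g = 1) :
    toConv (ι ∘ₗ f) * toConv (ι ∘ₗ g) = 1 := by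
  have := LinearMap.algHom_comp_convMul_distrib (Algebra.ofId R H) (toConv f) (toConv g)
  rw [h] at this
  exact congrArg toConv this.symm

theorem twistMul_id_Stw {γ γ' : H ⊗[R] H →ₗ[R] R} (h : toConv γ' * toConv γ = 1)
    (hu : toConv (uMap R H γ) * toConv (ubarMap R H γ') = 1) :
    twistMul R H (mulH R H) γ γ' ∘ₗ map LinearMap.id (Stw R H γ γ') ∘ₗ comul =
      (1 : WithConv (H →ₗ[R] H)).ofConv := by
  have h' : toConv (ι ∘ₗ γ') * toConv (ι ∘ₗ γ) = 1 := conv_linearMap_comp_eq_one h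
  have hu' : toConv (ι ∘ₗ uMap R H γ) * toConv (ι ∘ₗ ubarMap R H γ') = 1 :=
    conv_linearMap_comp_eq_one hu
  have e : ι ∘ₗ uMap R H γ = actL (ι ∘ₗ γ) (1 : WithConv (H →ₗ[R] H)).ofConv := by
    rw [actL_one]
    rfl
  rw [comp_id_Stw, twistMul_eq, mul_assoc, ← hu', e]
  rw [← toConv_ofConv (toConv (mul' R H) * toConv (ι ∘ₗ γ')), actL_mul, actL_mul,
    ← actL_mul (ι ∘ₗ γ'), h', one_actL, actL_one (mul' R H), comp_id_antipode]

theorem twistMul_Stw_id {γ γ' : H ⊗[R] H →ₗ[R] R} (h : toConv γ' * toConv γ = 1)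
    (hu : toConv (uMap R H γ) * toConv (ubarMap R H γ') = 1) :
    twistMul R H (mulH R H) γ γ' ∘ₗ map (Stw R H γ γ') LinearMap.id ∘ₗ comul =
      (1 : WithConv (H →ₗ[R] H)).ofConv := by
  have h' : toConv (ι ∘ₗ γ') * toConv (ι ∘ₗ γ) = 1 := conv_linearMap_comp_eq_one h
  have hu' : toConv (ι ∘ₗ uMap R H γ) * toConv (ι ∘ₗ ubarMap R H γ') = 1 :=
    conv_linearMap_comp_eq_one hu
  have e : ι ∘ₗ ubarMap R H γ' = actR (1 : WithConv (H →ₗ[R] H)).ofConv (ι ∘ₗ γ') := by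
    rw [one_actR]
    rfl
  rw [comp_Stw_id, twistMul_eq, ← hu', e]
  rw [← toConv_ofConv (toConv (ι ∘ₗ γ) * toConv (mul' R H)), actR_mul, actR_mul,
    ← actR_mul (ι ∘ₗ γ'), h', actR_one, one_actR (mul' R H), comp_antipode_id]

variable (R H) in
/-- The map `a ⊗ (b ⊗ c) ↦ (a ⊗ S b) ⊗ c`. -/
def midS : H ⊗[R] (H ⊗[R] H) →ₗ[R] (H ⊗[R] H) ⊗[R] H :=
  map (map .id (antipode R)) .id ∘ₗ (TensorProduct.assoc R H H H).symm.toLinearMap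

@[simp] theorem midS_tmul (a b c : H) :
    midS R H (a ⊗ₜ (b ⊗ₜ c)) = (a ⊗ₜ antipode R b) ⊗ₜ c := by
  simp [midS]

variable (R H) in
/-- The map `(a₁ ⊗ a₂) ⊗ ((b₁ ⊗ b₂) ⊗ (c₁ ⊗ c₂)) ↦ (a₁ ⊗ (b₂ ⊗ c₁)) ⊗ (a₂ ⊗ (b₁ ⊗ c₂))`. -/
def midSwap : (H ⊗[R] H) ⊗[R] ((H ⊗[R] H) ⊗[R] (H ⊗[R] H)) →ₗ[R]
    (H ⊗[R] (H ⊗[R] H)) ⊗[R] (H ⊗[R] (H ⊗[R] H)) :=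
  (tensorTensorTensorComm R H H (H ⊗[R] H) (H ⊗[R] H)).toLinearMap ∘ₗ
    map .id ((tensorTensorTensorComm R H H H H).toLinearMap ∘ₗ
      map (TensorProduct.comm R H H).toLinearMap .id)

@[simp] theorem midSwap_tmul (a₁ a₂ b₁ b₂ c₁ c₂ : H) :
    midSwap R H ((a₁ ⊗ₜ a₂) ⊗ₜ ((b₁ ⊗ₜ b₂) ⊗ₜ (c₁ ⊗ₜ c₂))) =
      (a₁ ⊗ₜ (b₂ ⊗ₜ c₁)) ⊗ₜ (a₂ ⊗ₜ (b₁ ⊗ₜ c₂)) := by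
  simp [midSwap]

theorem conv_midS (F G : (H ⊗[R] H) ⊗[R] H →ₗ[R] R) :
    (toConv F * toConv G).ofConv ∘ₗ midS R H =
      (mul' R R ∘ₗ map (F ∘ₗ midS R H) (G ∘ₗ midS R H) ∘ₗ midSwap R H) ∘ₗ
        map comul (map comul comul) := by
  ext a b c
  have := LinearMap.congr_fun (comul_antipode (R := R)) b
  simp [TensorProduct.comul_def] at this ⊢
  simp [this, ← (ℛ R a).eq, ← (ℛ R b).eq, ← (ℛ R c).eq, sum_tmul, tmul_sum]

theorem rid_counit_comul₃ :
    map .id ((TensorProduct.rid R H).toLinearMap ∘ₗ map .id counit) ∘ₗ comul₃ R H =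
      comul := by
  rw [comul₃, ← LinearMap.comp_assoc comul, ← TensorProduct.map_comp, LinearMap.comp_assoc,
    rid_counit_comul]
  simp

/-- Convolving with `g ⊗ h ⊗ k ↦ γ(gh ⊗ k)` has no effect after `h ↦ h₍₁₎ ⊗ S h₍₂₎ ⊗ h₍₃₎`. -/
theorem conv_mul_midS (F : (H ⊗[R] H) ⊗[R] H →ₗ[R] R) {γ : H ⊗[R] H →ₗ[R] R}
    (hγ : ∀ h : H, γ (1 ⊗ₜ h) = counit (R := R) h) :
    (toConv F * toConv (γ ∘ₗ map (mul' R H) .id)).ofConv ∘ₗ midS R H ∘ₗ comul₃ R H =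
      F ∘ₗ midS R H ∘ₗ comul₃ R H := by
  have h₁ : map comul (map comul comul) ∘ₗ comul₃ R H =
      ((TensorProduct.assoc R _ _ _).symm.toLinearMap ∘ₗ
        map .id (map .id (TensorProduct.assoc R _ _ _).symm.toLinearMap ∘ₗ
          (TensorProduct.assoc R _ _ _).toLinearMap)) ∘ₗ
        map .id (map comul .id) ∘ₗ map .id (map .id (comul₃ R H)) ∘ₗ comul₃ R H := by
    simp only [comul₃, coassoc_simps]
  have h₂ : (mul' R R ∘ₗ map (F ∘ₗ midS R H) ((γ ∘ₗ map (mul' R H) .id) ∘ₗ midS R H) ∘ₗ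
        midSwap R H) ∘ₗ ((TensorProduct.assoc R _ _ _).symm.toLinearMap ∘ₗ
        map .id (map .id (TensorProduct.assoc R _ _ _).symm.toLinearMap ∘ₗ
          (TensorProduct.assoc R _ _ _).toLinearMap)) ∘ₗ map .id (map comul .id) =
      F ∘ₗ midS R H ∘ₗ map .id ((TensorProduct.lid R _).toLinearMap ∘ₗ
        map counit (map .id ((TensorProduct.rid R _).toLinearMap ∘ₗ map .id counit))) := by
    ext a b c d e
    have : ∑ i ∈ (ℛ R b).index,
        γ (((ℛ R b).left i * antipode R ((ℛ R b).right i)) ⊗ₜ[R] e) =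
        counit (R := R) b * counit (R := R) e := by
      rw [← map_sum, ← sum_tmul, sum_mul_antipode_eq_algebraMap_counit,
        Algebra.algebraMap_eq_smul_one, ← smul_tmul', map_smul, hγ, smul_eq_mul]
    conv_lhs => simp [← (ℛ R b).eq, sum_tmul, tmul_sum]
    simp [← Finset.mul_sum, this]
    ring
  have h₃ : map .id ((TensorProduct.lid R _).toLinearMap ∘ₗ
        map counit (map .id ((TensorProduct.rid R _).toLinearMap ∘ₗ map .id counit))) ∘ₗ
        map .id (map .id (comul₃ R H)) ∘ₗ comul₃ R H = comul₃ R H := by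
    have : ((TensorProduct.lid R _).toLinearMap ∘ₗ map counit comul) ∘ₗ comul =
        comul (R := R) (A := H) := by
      trans comul ∘ₗ (TensorProduct.lid R _).toLinearMap ∘ₗ map counit .id ∘ₗ comul
      · simp only [coassoc_simps]
      · rw [lid_counit_comul, LinearMap.comp_id]
    rw [← LinearMap.comp_assoc, ← TensorProduct.map_comp, LinearMap.comp_assoc,
      ← TensorProduct.map_comp, rid_counit_comul₃]
    conv_lhs => rw [comul₃]
    rw [← LinearMap.comp_assoc, ← TensorProduct.map_comp]
    simp only [LinearMap.comp_id]
    rw [this]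
    rfl
  rw [← LinearMap.comp_assoc, conv_midS, LinearMap.comp_assoc, h₁]
  refine (congrArg (· ∘ₗ map .id (map .id (comul₃ R H)) ∘ₗ comul₃ R H) h₂).trans ?_
  exact congrArg (F ∘ₗ midS R H ∘ₗ ·) h₃

theorem conv_counit_midS (γ γ' : H ⊗[R] H →ₗ[R] R) :
    (toConv (mul' R R ∘ₗ map counit γ' ∘ₗ (TensorProduct.assoc R H H H).toLinearMap) *
      toConv (mul' R R ∘ₗ map γ counit)).ofConv ∘ₗ midS R H ∘ₗ comul₃ R H =
    (toConv (uMap R H γ) * toConv (ubarMap R H γ')).ofConv := by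
  have h₁ : mul' R R ∘ₗ map ((mul' R R ∘ₗ map counit γ' ∘ₗ
        (TensorProduct.assoc R H H H).toLinearMap) ∘ₗ midS R H)
        ((mul' R R ∘ₗ map γ counit) ∘ₗ midS R H) ∘ₗ midSwap R H =
      (mul' R R ∘ₗ map (γ ∘ₗ map .id (antipode R)) (γ' ∘ₗ map (antipode R) .id) ∘ₗ
        (TensorProduct.assoc R _ _ _).symm.toLinearMap ∘ₗ
        map .id (TensorProduct.assoc R _ _ _).toLinearMap) ∘ₗ
        map ((TensorProduct.lid R _).toLinearMap ∘ₗ map counit .id)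
          (map .id ((TensorProduct.rid R _).toLinearMap ∘ₗ map .id counit)) := by
    ext
    simp [← smul_tmul']
    ring
  have h₂ : ((TensorProduct.assoc R _ _ _).symm.toLinearMap ∘ₗ
        map .id (TensorProduct.assoc R _ _ _).toLinearMap) ∘ₗ
        map .id (map comul .id) ∘ₗ comul₃ R H = map comul comul ∘ₗ comul := by
    simp only [comul₃, coassoc_simps]
  have h₃ : ((TensorProduct.lid R H).toLinearMap ∘ₗ map counit .id) ∘ₗ comul = .id := by
    rw [LinearMap.comp_assoc, lid_counit_comul]
  have h₄ : ((TensorProduct.rid R H).toLinearMap ∘ₗ map .id counit) ∘ₗ comul = .id := by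
    rw [LinearMap.comp_assoc, rid_counit_comul]
  have h₅ : map ((TensorProduct.lid R H).toLinearMap ∘ₗ map counit .id)
      (map .id ((TensorProduct.rid R H).toLinearMap ∘ₗ map .id counit)) ∘ₗ
      map (comul (R := R) (A := H)) (map (comul (R := R) (A := H)) (comul (R := R) (A := H))) =
      map .id (map comul .id) := by
    rw [← TensorProduct.map_comp, ← TensorProduct.map_comp, h₃, h₄, LinearMap.id_comp]
  rw [← LinearMap.comp_assoc, conv_midS, h₁,
    LinearMap.comp_assoc (map comul (map comul comul)), h₅]
  refine (congrArg ((mul' R R ∘ₗ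
    map (γ ∘ₗ map .id (antipode R)) (γ' ∘ₗ map (antipode R) .id)) ∘ₗ ·) h₂).trans ?_
  rw [LinearMap.convMul_def]
  simp only [uMap, ubarMap, coassoc_simps]

theorem comp_mul_right_midS {γ : H ⊗[R] H →ₗ[R] R}
    (hγ : ∀ h : H, γ (h ⊗ₜ 1) = counit (R := R) h) :
    (γ ∘ₗ map .id (mul' R H) ∘ₗ (TensorProduct.assoc R H H H).toLinearMap) ∘ₗ
      midS R H ∘ₗ comul₃ R H = counit := by
  have h₁ : γ ∘ₗ map .id (mul' R H) ∘ₗ (TensorProduct.assoc R H H H).toLinearMap ∘ₗ midS R H =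
      γ ∘ₗ map .id (mul' R H ∘ₗ map (antipode R) .id) := by
    ext
    simp
  have h₂ : γ ∘ₗ map .id ι = counit ∘ₗ (TensorProduct.rid R H).toLinearMap := by
    ext
    simp [hγ]
  refine (congrArg (· ∘ₗ comul₃ R H) h₁).trans ?_
  rw [comul₃, LinearMap.comp_assoc, ← LinearMap.comp_assoc comul, ← TensorProduct.map_comp,
    LinearMap.comp_assoc, comp_antipode_id, LinearMap.convOne_def, ofConv_toConv,
    LinearMap.id_comp, ← LinearMap.comp_id LinearMap.id, TensorProduct.map_comp,
    LinearMap.comp_assoc, ← LinearMap.comp_assoc _ _ γ, h₂, LinearMap.comp_assoc,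
    rid_counit_comul, LinearMap.comp_id]

theorem conv_inv_counit_assoc {γ γ' : H ⊗[R] H →ₗ[R] R} (h : toConv γ' * toConv γ = 1) :
    toConv (mul' R R ∘ₗ map counit γ' ∘ₗ (TensorProduct.assoc R H H H).toLinearMap) *
      toConv (mul' R R ∘ₗ map counit γ ∘ₗ (TensorProduct.assoc R H H H).toLinearMap) = 1 := by
  have h₁ := LinearMap.convMul_comp_coalgHom_distrib (toConv (mul' R R ∘ₗ map counit γ'))
    (toConv (mul' R R ∘ₗ map counit γ)) (Coalgebra.TensorProduct.assoc R R H H H).toCoalgHom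
  have h₂ := LinearMap.algHom_comp_convMul_distrib (Algebra.TensorProduct.lmul' R (S := R))
    (toConv (map (counit (A := H)) γ')) (toConv (map counit γ))
  have h₃ := TensorProduct.map_convMul_map (f := toConv (counit (R := R) (A := H)))
    (h := toConv counit) (g := toConv γ') (k := toConv γ)
  have h₄ : toConv (counit (R := R) (A := H)) * toConv counit = toConv counit :=
    mul_one (1 : WithConv (H →ₗ[R] R))
  simp only at h₁ h₂ h₃
  rw [h₃, h₄, h] at h₂
  apply ofConv_injective
  refine h₁.symm.trans ?_
  refine (congrArg (· ∘ₗ _) h₂.symm).trans ?_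
  ext
  simp
  ring

theorem IsCocycle.inv_mul_eq_one {γ γ' : H ⊗[R] H →ₗ[R] R}
    (hco : IsCocycle R H (mulH R H) γ γ') : toConv γ' * toConv γ = 1 := by
  have h := hco.conv_inv_left
  rw [comul2_eq, counit2_eq, convOn_eq] at h
  exact congrArg toConv h

/-- `ū_γ` is a right convolution inverse of `u_γ`. -/
theorem uMap_mul_ubarMap {γ γ' : H ⊗[R] H →ₗ[R] R} (hco : IsCocycle R H (mulH R H) γ γ') :
    toConv (uMap R H γ) * toConv (ubarMap R H γ') = 1 := by
  have hc := hco.cocycle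
  rw [comulC3_eq, convOn_eq, convOn_eq] at hc
  have hc' := congrArg (toConv (mul' R R ∘ₗ map counit γ' ∘ₗ
    (TensorProduct.assoc R H H H).toLinearMap) * toConv ·) hc
  simp only [toConv_ofConv] at hc'
  rw [← mul_assoc, ← mul_assoc, conv_inv_counit_assoc hco.inv_mul_eq_one, one_mul] at hc'
  apply ofConv_injective
  rw [← conv_counit_midS, ← conv_mul_midS _ hco.unital_left, toConv_ofConv, hc',
    ofConv_toConv, comp_mul_right_midS hco.unital_right]
  rfl

end

/-- `S_γ = u_γ * S * ū_γ` is an antipode for the twisted bialgebra: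
`S_γ(h₍₁₎) ·_γ h₍₂₎ = ε(h)1 = h₍₁₎ ·_γ S_γ(h₍₂₎)`. -/
theorem Stw_antipode (R H : Type*) [CommRing R] [Ring H] [HopfAlgebra R H]
    (γ γ' : H ⊗[R] H →ₗ[R] R) (hco : IsCocycle R H (mulH R H) γ γ') :
    (twistMul R H (mulH R H) γ γ' ∘ₗ map (Stw R H γ γ') LinearMap.id ∘ₗ (Coalgebra.comul (R := R))
        = Algebra.linearMap R H ∘ₗ (Coalgebra.counit (R := R)))
    ∧ (twistMul R H (mulH R H) γ γ' ∘ₗ map LinearMap.id (Stw R H γ γ') ∘ₗ (Coalgebra.comul (R := R))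
        = Algebra.linearMap R H ∘ₗ (Coalgebra.counit (R := R))) :=
  ⟨twistMul_Stw_id hco.inv_mul_eq_one (uMap_mul_ubarMap hco),
    twistMul_id_Stw hco.inv_mul_eq_one (uMap_mul_ubarMap hco)⟩
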